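/- Let A and B be m×m real matrices with spectral radius sp(A) < 1. Then for every n ≥ 0, both series below converge absolutely and ∑_{j≥0} ((n+j)! / j!) · P_{n+j}(A,B) = n! · Pₙ(A,B) · ∑_{j≥0} P_j(A, nA + B). (This is the value Mₙ(A,B) of the n-th derivative of the matrix generating function P(z;A,B) = ∑_{k≥0} zᵏ Pₖ(A,B) at z = 1, expressed as n! Pₙ P(1;A,nA+B).) -/

import Mathlib

open Matrix

/-- `Pmat A B n = ∏_{i=1}^{n} (A + (1/i) B)`. -/
noncomputable def Pmat {m : ℕ} (A B : Matrix (Fin m) (Fin m) ℝ) :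
    ℕ → Matrix (Fin m) (Fin m) ℝ
  | 0 => 1
  | k + 1 => Pmat A B k * (A + ((k + 1 : ℕ) : ℝ)⁻¹ • B)

section Convergence

attribute [local instance] Matrix.linftyOpNormedRing Matrix.linftyOpNormedAlgebra

open Filter Topology Finset

/-- In a complex Banach algebra, an element of spectral radius less than one has a power of norm
less than one. -/
theorem exists_norm_pow_lt_one_of_spectralRadius_lt_one {R : Type*} [NormedRing R]
    [NormedAlgebra ℂ R] [CompleteSpace R] {a : R} (ha : spectralRadius ℂ a < 1) :
    ∃ k : ℕ, ‖a ^ k‖ < 1 := by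
  have h := (spectrum.pow_nnnorm_pow_one_div_tendsto_nhds_spectralRadius a).eventually_lt_const ha
  obtain ⟨k, hk, hk0⟩ := (h.and (eventually_gt_atTop 0)).exists
  refine ⟨k, ?_⟩
  by_contra! hle
  refine hk.not_ge (ENNReal.one_le_rpow ?_ (by positivity))
  exact_mod_cast hle

theorem Matrix.linfty_opNorm_map_algebraMap {m : ℕ} (A : Matrix (Fin m) (Fin m) ℝ) :
    ‖A.map (algebraMap ℝ ℂ)‖ = ‖A‖ := by
  simp [Matrix.linfty_opNorm_def]

/-- A nonnegative sequence that eventually contracts over a fixed shift is summable. -/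
theorem summable_of_eventually_shift_le_mul {g : ℕ → ℝ} (hg : ∀ n, 0 ≤ g n) {r : ℝ} (hr : r < 1)
    {k : ℕ} (h : ∀ᶠ n in atTop, g (n + k) ≤ r * g n) : Summable g := by
  obtain ⟨N, hN⟩ := eventually_atTop.1 h
  rw [← summable_nat_add_iff N]
  refine summable_of_sum_range_le (c := (∑ i ∈ range k, g (i + N)) / (1 - r))
    (fun n => hg _) fun M => ?_
  have h1 : ∑ i ∈ range M, g (i + N) ≤ ∑ i ∈ range (k + M), g (i + N) :=
    sum_le_sum_of_subset_of_nonneg (range_mono (by omega)) fun _ _ _ => hg _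
  have h2 : ∑ i ∈ range M, g (k + i + N) ≤ r * ∑ i ∈ range M, g (i + N) := by
    rw [mul_sum]
    refine sum_le_sum fun i _ => ?_
    rw [show k + i + N = i + N + k by ring]
    exact hN _ (by omega)
  rw [sum_range_add] at h1
  rw [le_div_iff₀ (by linarith)]
  linarith

theorem Pmat_add_eq_mul_tendsto {m : ℕ} (A B : Matrix (Fin m) (Fin m) ℝ) (k : ℕ) :
    ∃ Q : ℕ → Matrix (Fin m) (Fin m) ℝ, Tendsto Q atTop (𝓝 (A ^ k)) ∧
      ∀ n, Pmat A B (n + k) = Pmat A B n * Q n := by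
  induction k with
  | zero => exact ⟨fun _ => 1, by simp, by simp⟩
  | succ k ih =>
    obtain ⟨Q, hQ, h⟩ := ih
    refine ⟨fun n => Q n * (A + ((n + k + 1 : ℕ) : ℝ)⁻¹ • B), ?_, fun n => ?_⟩
    · have h0 : Tendsto (fun n : ℕ => ((n + k + 1 : ℕ) : ℝ)⁻¹) atTop (𝓝 0) :=
        (tendsto_inv_atTop_nhds_zero_nat (𝕜 := ℝ)).comp (tendsto_add_atTop_nat (k + 1))
      simpa [pow_succ] using hQ.mul ((h0.smul_const B).const_add A)
    · rw [← add_assoc, Pmat, h, mul_assoc]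

theorem summable_Pmat {m : ℕ} (A B : Matrix (Fin m) (Fin m) ℝ)
    (hA : spectralRadius ℂ (A.map (algebraMap ℝ ℂ)) < 1) : Summable (Pmat A B) := by
  obtain ⟨k, hk⟩ := exists_norm_pow_lt_one_of_spectralRadius_lt_one hA
  rw [← Matrix.map_pow, Matrix.linfty_opNorm_map_algebraMap] at hk
  obtain ⟨r, hkr, hr⟩ := exists_between hk
  obtain ⟨Q, hQ, h⟩ := Pmat_add_eq_mul_tendsto A B k
  refine Summable.of_norm (summable_of_eventually_shift_le_mul (fun _ => norm_nonneg _) hr (k := k) ?_)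
  filter_upwards [hQ.norm.eventually_lt_const hkr] with n hn
  rw [h, mul_comm r]
  exact (norm_mul_le _ _).trans (by gcongr)

end Convergence

theorem factorial_smul_Pmat_add {m : ℕ} (A B : Matrix (Fin m) (Fin m) ℝ) (n j : ℕ) :
    (((n + j).factorial : ℝ) / (j.factorial : ℝ)) • Pmat A B (n + j) =
      (n.factorial : ℝ) • (Pmat A B n * Pmat A ((n : ℝ) • A + B) j) := by
  induction j with
  | zero => simp [Pmat]
  | succ j ih =>
    have hstep : A + ((j + 1 : ℕ) : ℝ)⁻¹ • ((n : ℝ) • A + B) =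
        (((n + j + 1 : ℕ) : ℝ) / ((j + 1 : ℕ) : ℝ)) • (A + ((n + j + 1 : ℕ) : ℝ)⁻¹ • B) := by
      ext a b
      simp only [Matrix.add_apply, Matrix.smul_apply, smul_eq_mul]
      push_cast
      field_simp
      ring
    rw [← add_assoc, Pmat, Pmat, hstep, ← mul_assoc, Matrix.mul_smul, smul_comm,
      ← Matrix.smul_mul (n.factorial : ℝ), ← ih, Matrix.smul_mul, smul_smul, Nat.factorial_succ, Nat.factorial_succ]
    congr 1
    push_cast
    field_simp

/-- If `sp(A) < 1`, then `Mₙ(A,B) = ∑_{j≥0} ((n+j)!/j!) P_{n+j}(A,B)` converges and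
equals `n! Pₙ(A,B) P(1; A, nA+B)`. -/
theorem Mn_eq_factorial_Pmat_mul {m : ℕ} (A B : Matrix (Fin m) (Fin m) ℝ)
    (hA : spectralRadius ℂ (A.map (algebraMap ℝ ℂ)) < 1) :
    ∀ n : ℕ,
      Summable (fun j : ℕ =>
        (((n + j).factorial : ℝ) / (j.factorial : ℝ)) • Pmat A B (n + j)) ∧
      Summable (fun j : ℕ => Pmat A ((n : ℝ) • A + B) j) ∧
      ∑' j : ℕ, (((n + j).factorial : ℝ) / (j.factorial : ℝ)) • Pmat A B (n + j) =
        (n.factorial : ℝ) •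
          (Pmat A B n * ∑' j : ℕ, Pmat A ((n : ℝ) • A + B) j) := by
  intro n
  have h := summable_Pmat A ((n : ℝ) • A + B) hA
  simp_rw [factorial_smul_Pmat_add]
  refine ⟨(h.mul_left _).const_smul _, h, ?_⟩
  rw [(h.mul_left _).tsum_const_smul, h.tsum_mul_left]
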